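/- For every integer n ≥ 0, p(n) = - ∑_{k=2}^{n+2} μ(k) · S_k^{≥2}(n+2), where p(n) is the number of partitions of n and μ is the Möbius function (the sum is taken in the integers). -/

import Mathlib

/-- `S_k^{≥ r}(n)`: the total number of parts equal to `k`, counted over all partitions of `n`
whose parts are all at least `r`. -/
def Sge (k r n : ℕ) : ℕ :=
  ∑ P : Nat.Partition n, if ∀ i ∈ P.parts, r ≤ i then P.parts.count k else 0

/-- Adding a part `k ≥ r` is a bijection from the partitions of `n` with parts at least `r`
onto those of `n + k` that contain `k`. -/
theorem sum_restricted_add_filter_mem {M : Type*} [AddCommMonoid M] {k r : ℕ} (n : ℕ)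
    (hk : 0 < k) (hr : r ≤ k) (f : Multiset ℕ → M) :
    ∑ P ∈ (Nat.Partition.restricted (n + k) (r ≤ ·)).filter (k ∈ ·.parts), f P.parts =
      ∑ P ∈ Nat.Partition.restricted n (r ≤ ·), f (k ::ₘ P.parts) := by
  symm
  refine Finset.sum_bij
    (fun P _ => ⟨k ::ₘ P.parts, by grind, by simp [P.parts_sum, add_comm]⟩) ?_ ?_ ?_ ?_
  · intro P hP
    simpa [Nat.Partition.restricted, hr] using hP
  · intro P _ Q _ h
    exact Nat.Partition.ext (by simpa using h)
  · intro P hP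
    simp only [Nat.Partition.restricted, Finset.mem_filter, Finset.mem_univ, true_and] at hP
    refine ⟨⟨P.parts.erase k, fun hi => P.parts_pos (Multiset.mem_of_mem_erase hi), ?_⟩, ?_, ?_⟩
    · have h := congrArg Multiset.sum (Multiset.cons_erase hP.2)
      rw [Multiset.sum_cons, P.parts_sum] at h
      omega
    · simpa [Nat.Partition.restricted] using fun i hi => hP.1 i (Multiset.mem_of_mem_erase hi)
    · exact Nat.Partition.ext (Multiset.cons_erase hP.2)
  · intros
    rfl

theorem Sge_eq_sum_restricted (k r n : ℕ) :
    Sge k r n = ∑ P ∈ Nat.Partition.restricted n (r ≤ ·), P.parts.count k := by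
  rw [Sge, Nat.Partition.restricted, Finset.sum_filter]

theorem Sge_eq_zero_of_lt {k n : ℕ} (r : ℕ) (h : n < k) : Sge k r n = 0 := by
  rw [Sge_eq_sum_restricted]
  refine Finset.sum_eq_zero fun P _ => Multiset.count_eq_zero.2 fun hk => ?_
  exact (Nat.Partition.le_of_mem_parts hk).not_gt h

theorem Sge_add {k r : ℕ} (n : ℕ) (hk : 0 < k) (hr : r ≤ k) :
    Sge k r (n + k) = Sge k r n + (Nat.Partition.restricted n (r ≤ ·)).card := by
  rw [Sge_eq_sum_restricted, Sge_eq_sum_restricted,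
    ← Finset.sum_filter_of_ne (s := Nat.Partition.restricted (n + k) (r ≤ ·))
      (p := (k ∈ ·.parts)) (fun P _ h => Multiset.count_ne_zero.1 h),
    sum_restricted_add_filter_mem n hk hr (fun s => s.count k)]
  simp [Finset.sum_add_distrib]

/-- Counting parts equal to `k` by their multiplicity: each multiple `m` of `k` contributes
the partitions of `n - m`. -/
theorem Sge_eq_sum_multiples {k r : ℕ} (hk : 0 < k) (hr : r ≤ k) (n : ℕ) :
    Sge k r n = ∑ m ∈ Finset.Ico 1 (n + 1),
      if k ∣ m then (Nat.Partition.restricted (n - m) (r ≤ ·)).card else 0 := by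
  induction n using Nat.strong_induction_on with
  | _ n ih =>
    obtain h | h := lt_or_ge n k
    · rw [Sge_eq_zero_of_lt r h]
      refine (Finset.sum_eq_zero fun m hm => if_neg fun hd => ?_).symm
      rw [Finset.mem_Ico] at hm
      have := Nat.le_of_dvd (by omega) hd
      omega
    · obtain ⟨n, rfl⟩ := Nat.exists_eq_add_of_le' h
      rw [Sge_add n hk hr, ih n (by omega),
        ← Finset.sum_Ico_consecutive _ hk (show k ≤ n + k + 1 by omega),
        Finset.sum_eq_zero (s := Finset.Ico 1 k), zero_add,
        Finset.sum_eq_sum_Ico_succ_bot (show k < n + k + 1 by omega), add_comm]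
      · congr 1
        · rw [if_pos dvd_rfl, Nat.add_sub_cancel]
        · rw [show n + k + 1 = n + 1 + k by omega, add_comm k 1, ← Finset.sum_Ico_add']
          refine Finset.sum_congr rfl fun m _ => ?_
          rw [Nat.add_sub_add_right]
          simp
      · intro m hm
        rw [Finset.mem_Ico] at hm
        exact if_neg fun hd => by
          have := Nat.le_of_dvd (by omega) hd
          omega

/-- Removing all parts equal to `1`. -/
theorem card_partition_eq_sum_restricted (n : ℕ) :
    Fintype.card (Nat.Partition n) =
      ∑ m ∈ Finset.range (n + 1), (Nat.Partition.restricted m (2 ≤ ·)).card := by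
  have restricted_one (n : ℕ) : Nat.Partition.restricted n (1 ≤ ·) = Finset.univ :=
    Finset.filter_true_of_mem fun P _ i hi => P.parts_pos hi
  induction n with
  | zero => simp [Nat.Partition.restricted]
  | succ n ih =>
    rw [Finset.sum_range_succ, ← ih, ← Finset.card_univ, ← Finset.card_univ,
      ← Finset.card_filter_add_card_filter_not (s := Finset.univ) (1 ∈ ·.parts)]
    congr 1
    · have h := sum_restricted_add_filter_mem n one_pos le_rfl (fun _ => 1)
      simpa only [restricted_one, Finset.sum_const, smul_eq_mul, mul_one] using h
    · congr 1
      ext P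
      simp only [Nat.Partition.restricted, Finset.mem_filter, Finset.mem_univ, true_and]
      refine ⟨fun h i hi => ?_, fun h h1 => absurd (h 1 h1) (by norm_num)⟩
      have := P.parts_pos hi
      have : i ≠ 1 := fun e => h (e ▸ hi)
      omega

theorem sum_moebius_Icc_two_dvd {m N : ℕ} (hm : 0 < m) (hN : m ≤ N) :
    (∑ k ∈ Finset.Icc 2 N, if k ∣ m then ArithmeticFunction.moebius k else 0) =
      if m = 1 then 0 else -1 := by
  have hdiv : (Finset.Icc 1 N).filter (· ∣ m) = m.divisors := by
    ext k
    simp only [Finset.mem_filter, Finset.mem_Icc, Nat.mem_divisors]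
    refine ⟨fun h => ⟨h.2, hm.ne'⟩, fun h => ⟨⟨Nat.pos_of_dvd_of_pos h.1 hm, ?_⟩, h.1⟩⟩
    exact (Nat.le_of_dvd hm h.1).trans hN
  have h : ∑ k ∈ m.divisors, ArithmeticFunction.moebius k = if m = 1 then 1 else 0 := by
    rw [← ArithmeticFunction.coe_mul_zeta_apply, ArithmeticFunction.moebius_mul_coe_zeta,
      ArithmeticFunction.one_apply]
  rw [← hdiv, Finset.sum_filter, ← Finset.add_sum_Ioc_eq_sum_Icc (hm.trans_le hN)] at h
  have hIoc : Finset.Ioc 1 N = Finset.Icc 2 N := by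
    ext k
    simp only [Finset.mem_Ioc, Finset.mem_Icc]
    omega
  rw [hIoc] at h
  simp only [one_dvd, if_true, ArithmeticFunction.moebius_apply_one] at h
  split_ifs at h ⊢ <;> linarith

/-- For every `n ≥ 0`, `p(n) = - ∑_{k=2}^{n+2} μ(k) · S_k^{≥2}(n+2)` (in the integers). -/
theorem partition_eq_neg_sum_moebius (n : ℕ) :
    (Fintype.card (Nat.Partition n) : ℤ) =
      - ∑ k ∈ Finset.Icc 2 (n + 2),
          (ArithmeticFunction.moebius k : ℤ) * (Sge k 2 (n + 2) : ℤ) := by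
  let q (m : ℕ) : ℕ := (Nat.Partition.restricted m (2 ≤ ·)).card
  have hsum : ∑ k ∈ Finset.Icc 2 (n + 2),
      (ArithmeticFunction.moebius k : ℤ) * (Sge k 2 (n + 2) : ℤ) =
      ∑ m ∈ Finset.Ico 1 (n + 3), (if m = 1 then 0 else -1) * (q (n + 2 - m) : ℤ) := by
    calc
      _ = ∑ k ∈ Finset.Icc 2 (n + 2), ∑ m ∈ Finset.Ico 1 (n + 3),
          (if k ∣ m then ArithmeticFunction.moebius k else 0) * (q (n + 2 - m) : ℤ) := by
        refine Finset.sum_congr rfl fun k hk => ?_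
        have hk2 := (Finset.mem_Icc.1 hk).1
        rw [Sge_eq_sum_multiples (by omega) hk2, Nat.cast_sum, Finset.mul_sum]
        refine Finset.sum_congr rfl fun m _ => ?_
        split_ifs <;> simp [q]
      _ = _ := by
        rw [Finset.sum_comm]
        refine Finset.sum_congr rfl fun m hm => ?_
        rw [Finset.mem_Ico] at hm
        rw [← Finset.sum_mul, sum_moebius_Icc_two_dvd (by omega) (by omega)]
  rw [hsum, card_partition_eq_sum_restricted, Finset.sum_eq_sum_Ico_succ_bot (by omega),
    Finset.sum_Ico_eq_sum_range, ← Finset.sum_range_reflect, Nat.cast_sum]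
  simp only [if_true, zero_mul, zero_add, ← Finset.sum_neg_distrib]
  refine Finset.sum_congr (by congr 1) fun m hm => ?_
  rw [if_neg (by omega), show n + 2 - (1 + 1 + m) = n + 1 - 1 - m by omega]
  simp [q]
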